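/- arXiv:1403.0417 — 2 statements merged into one kernel-verified Lean document; each statement's English description precedes it below -/
import Mathlib

section
/- Let f : 𝔽₂ⁿ → 𝔽₂, define f' : 𝔽₂ⁿ × 𝔽₂¹⁰ → 𝔽₂ by f'(x, y) = f(x) · y₁ · y₂ ⋯ y₁₀, and let g : 𝔽₂ⁿ × 𝔽₂¹⁰ → 𝔽₂ be any balanced function (i.e. |g⁻¹(1)| = 2^{n+9}). Then the number of inputs z ∈ 𝔽₂ⁿ × 𝔽₂¹⁰ with f'(z) = g(z) is at most 513 · 2ⁿ; in particular it is strictly smaller than the number of inputs on which f' agrees with the constant zero function, which is at least (2¹⁰ − 1) · 2ⁿ. -/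
theorem ZMod.two_eq_one_of_ne_zero {a : ZMod 2} (ha : a ≠ 0) : a = 1 := by
  revert a
  decide

/-- Multiplying `f` by all the coordinates of a second argument leaves a support with at most one
point above each `x`. -/
theorem card_mul_prod_ne_zero_le {α ι : Type*} [Fintype α] [Fintype ι] [DecidableEq ι]
    (f : α → ZMod 2) :
    (Finset.univ.filter
      (fun z : α × (ι → ZMod 2) => ¬ f z.1 * ∏ i, z.2 i = 0)).card ≤ Fintype.card α := by
  rw [← Finset.card_univ]
  refine Finset.card_le_card_of_injOn Prod.fst (fun _ _ => by simp) ?_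
  have h_ones : ∀ z : α × (ι → ZMod 2), ¬ f z.1 * ∏ i, z.2 i = 0 → z.2 = fun _ => 1 := by
    intro z hz
    funext i
    exact ZMod.two_eq_one_of_ne_zero
      (Finset.prod_ne_zero_iff.mp (right_ne_zero_of_mul hz) i (Finset.mem_univ i))
  intro z hz w hw hzw
  simp only [Finset.coe_filter, Finset.mem_univ, true_and, Set.mem_ofPred_eq] at hz hw
  exact Prod.ext hzw ((h_ones z hz).trans (h_ones w hw).symm)

/-- Two functions `h` and `g` agree at most on the complement of `g⁻¹(1)` together with the support of `h`. -/
theorem card_eq_le_card_ne_one_add_card_ne_zero {β : Type*} [Fintype β] (h g : β → ZMod 2) :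
    (Finset.univ.filter (fun z => h z = g z)).card ≤
      (Finset.univ.filter (fun z => ¬ g z = 1)).card +
        (Finset.univ.filter (fun z => ¬ h z = 0)).card := by
  classical
  refine le_trans (Finset.card_le_card ?_) (Finset.card_union_le _ _)
  intro z hz
  simp only [Finset.mem_filter, Finset.mem_univ, true_and, Finset.mem_union] at hz ⊢
  by_cases h0 : h z = 0
  · left
    rw [← hz, h0]
    exact zero_ne_one
  · exact Or.inr h0

/-- For `f' (x, y) = f x * ∏ i, y i` and any balanced `g` on `𝔽₂ⁿ × 𝔽₂¹⁰`
(i.e. `|g⁻¹(1)| = 2^(n+9)`), the number of inputs where `f'` agrees with `g` is at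
most `513 * 2ⁿ`; in particular it is strictly smaller than the agreement of `f'`
with the constant zero function, which is at least `(2¹⁰ - 1) * 2ⁿ`. -/
theorem padded_agreement_with_balanced (n : ℕ) (f : (Fin n → ZMod 2) → ZMod 2)
    (g : (Fin n → ZMod 2) × (Fin 10 → ZMod 2) → ZMod 2)
    (hg : (Finset.univ.filter
        (fun z : (Fin n → ZMod 2) × (Fin 10 → ZMod 2) => g z = 1)).card = 2 ^ (n + 9)) :
    (Finset.univ.filter
        (fun z : (Fin n → ZMod 2) × (Fin 10 → ZMod 2) =>
          f z.1 * ∏ i, z.2 i = g z)).card ≤ 513 * 2 ^ n ∧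
    (Finset.univ.filter
        (fun z : (Fin n → ZMod 2) × (Fin 10 → ZMod 2) =>
          f z.1 * ∏ i, z.2 i = g z)).card
      < (Finset.univ.filter
          (fun z : (Fin n → ZMod 2) × (Fin 10 → ZMod 2) =>
            f z.1 * ∏ i, z.2 i = 0)).card ∧
    (2 ^ 10 - 1) * 2 ^ n
      ≤ (Finset.univ.filter
          (fun z : (Fin n → ZMod 2) × (Fin 10 → ZMod 2) =>
            f z.1 * ∏ i, z.2 i = 0)).card := by
  have h_supp := card_mul_prod_ne_zero_le (ι := Fin 10) f
  have h_agree := card_eq_le_card_ne_one_add_card_ne_zero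
    (fun z : (Fin n → ZMod 2) × (Fin 10 → ZMod 2) => f z.1 * ∏ i, z.2 i) g
  have h_g := Finset.card_filter_add_card_filter_not
    (s := (Finset.univ : Finset ((Fin n → ZMod 2) × (Fin 10 → ZMod 2)))) (fun z => g z = 1)
  have h_f := Finset.card_filter_add_card_filter_not
    (s := (Finset.univ : Finset ((Fin n → ZMod 2) × (Fin 10 → ZMod 2))))
    (fun z => f z.1 * ∏ i, z.2 i = 0)
  simp only [Finset.card_univ, Fintype.card_prod, Fintype.card_fun, ZMod.card,
    Fintype.card_fin] at h_supp h_g h_f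
  rw [hg, pow_add] at h_g
  have h_pos : 0 < 2 ^ n := by positivity
  refine ⟨?_, ?_, ?_⟩ <;> omega
end

section
/- Let f : 𝔽₂ⁿ → 𝔽₂ and define f' : 𝔽₂ⁿ × 𝔽₂¹⁰ → 𝔽₂ by f'(x, y) = f(x) · y₁ · y₂ ⋯ y₁₀. Then the constant zero function is a best affine approximation of f': for every affine function g : 𝔽₂ⁿ × 𝔽₂¹⁰ → 𝔽₂, the number of z ∈ 𝔽₂ⁿ × 𝔽₂¹⁰ with f'(z) = g(z) is at most the number of z with f'(z) = 0. -/
/-- Over `𝔽₂`, a function with `g (z + t) = g z + g t + g 0` that is not identically zero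
vanishes on at most half of its domain. -/
theorem two_mul_card_zeros_le {G : Type*} [AddCommGroup G] [Fintype G] (g : G → ZMod 2)
    (hadd : ∀ z t, g (z + t) = g z + g t + g 0) (hne : ∃ z, g z ≠ 0) :
    2 * (Finset.univ.filter (fun z => g z = 0)).card ≤ Fintype.card G := by
  have htwo : ∀ u : ZMod 2, u = 0 ∨ u = 1 := by decide
  have hcompl := Finset.card_filter_add_card_filter_not
    (s := (Finset.univ : Finset G)) (fun z => g z = 0)
  rw [Finset.card_univ] at hcompl
  suffices (Finset.univ.filter (fun z => g z = 0)).card ≤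
      (Finset.univ.filter (fun z => ¬ g z = 0)).card by omega
  by_cases hconst : ∀ t, g t = g 0
  · obtain ⟨z, hz⟩ := hne
    have h0 : g 0 ≠ 0 := hconst z ▸ hz
    simp [hconst, h0]
  · push Not at hconst
    obtain ⟨t, ht⟩ := hconst
    refine Finset.card_le_card_of_injOn (fun z => z + t) ?_ (add_left_injective t).injOn
    intro z hz
    simp only [Finset.coe_filter, Finset.mem_univ, true_and, Set.mem_ofPred_eq] at hz ⊢
    rw [hadd, hz]
    rcases htwo (g t) with h | h <;> rcases htwo (g 0) with h' | h' <;> simp_all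

/-- A function on `X × 𝔽₂ᵏ` multiplied by all the coordinates of `𝔽₂ᵏ` has at most `|X|`
points in its support. -/
theorem card_support_mul_prod_le {X ι : Type*} [Fintype X] [Fintype ι] [DecidableEq ι]
    (f : X → ZMod 2) :
    (Finset.univ.filter (fun z : X × (ι → ZMod 2) => ¬ f z.1 * ∏ i, z.2 i = 0)).card
      ≤ Fintype.card X := by
  have hone : ∀ u : ZMod 2, u ≠ 0 → u = 1 := by decide
  rw [← Finset.card_univ]
  refine Finset.card_le_card_of_injOn Prod.fst (fun _ _ => Finset.mem_coe.2 (Finset.mem_univ _)) ?_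
  have key : ∀ z : X × (ι → ZMod 2), ¬ f z.1 * ∏ i, z.2 i = 0 → ∀ i, z.2 i = 1 := by
    intro z hz i
    exact hone _ (Finset.prod_ne_zero_iff.1 (right_ne_zero_of_mul hz) i (Finset.mem_univ i))
  intro z hz w hw hzw
  simp only [Finset.coe_filter, Finset.mem_univ, true_and, Set.mem_ofPred_eq] at hz hw
  exact Prod.ext hzw (funext fun i => (key z hz i).trans (key w hw i).symm)

/-- For `f' (x, y) = f x * ∏ i, y i`, the constant zero function is a best affine
approximation of `f'`: for every affine `g` on `𝔽₂ⁿ × 𝔽₂¹⁰` (given by coefficient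
vectors `a : 𝔽₂ⁿ`, `b : 𝔽₂¹⁰` and a constant `c`), the agreement of `f'` with `g`
is at most the agreement of `f'` with `0`. -/
theorem zero_is_best_affine_approx (n : ℕ) (f : (Fin n → ZMod 2) → ZMod 2)
    (g : (Fin n → ZMod 2) × (Fin 10 → ZMod 2) → ZMod 2)
    (hg : ∃ (a : Fin n → ZMod 2) (b : Fin 10 → ZMod 2) (c : ZMod 2),
        ∀ z : (Fin n → ZMod 2) × (Fin 10 → ZMod 2),
          g z = (∑ i, a i * z.1 i) + (∑ j, b j * z.2 j) + c) :
    (Finset.univ.filter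
        (fun z : (Fin n → ZMod 2) × (Fin 10 → ZMod 2) =>
          f z.1 * ∏ i, z.2 i = g z)).card
      ≤ (Finset.univ.filter
          (fun z : (Fin n → ZMod 2) × (Fin 10 → ZMod 2) =>
            f z.1 * ∏ i, z.2 i = 0)).card := by
  obtain ⟨a, b, c, hg⟩ := hg
  have hadd : ∀ z t, g (z + t) = g z + g t + g 0 := by
    intro z t
    have hc : c + c = 0 := CharTwo.add_self_eq_zero c
    simp only [hg, Prod.fst_add, Prod.snd_add, Pi.add_apply, mul_add, Finset.sum_add_distrib,
      Prod.fst_zero, Prod.snd_zero, Pi.zero_apply, mul_zero, Finset.sum_const_zero]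
    linear_combination -hc
  by_cases hne : ∃ z, g z ≠ 0
  · have hzeros := two_mul_card_zeros_le g hadd hne
    have hsupp := card_support_mul_prod_le (ι := Fin 10) f
    have hcompl := Finset.card_filter_add_card_filter_not
      (s := (Finset.univ : Finset ((Fin n → ZMod 2) × (Fin 10 → ZMod 2))))
      (fun z => f z.1 * ∏ i, z.2 i = 0)
    have hcard : Fintype.card ((Fin n → ZMod 2) × (Fin 10 → ZMod 2)) =
        Fintype.card (Fin n → ZMod 2) * 1024 := by
      rw [Fintype.card_prod]
      simp [ZMod.card]
    have hagree : (Finset.univ.filter (fun z : (Fin n → ZMod 2) × (Fin 10 → ZMod 2) =>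
          f z.1 * ∏ i, z.2 i = g z)).card ≤
        (Finset.univ.filter (fun z => g z = 0)).card +
        (Finset.univ.filter (fun z : (Fin n → ZMod 2) × (Fin 10 → ZMod 2) =>
          ¬ f z.1 * ∏ i, z.2 i = 0)).card := by
      refine (Finset.card_le_card ?_).trans (Finset.card_union_le _ _)
      intro z hz
      simp only [Finset.mem_filter, Finset.mem_univ, true_and, Finset.mem_union] at hz ⊢
      rw [hz]
      exact em _
    rw [Finset.card_univ] at hcompl
    omega
  · push Not at hne
    simp only [hne, le_refl]
end
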